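/- Let A be a commutative noetherian ring, x = x_1,…,x_t ∈ A with 𝔞 = (x) and dim A/𝔞 = 1, and let M be an A-module with Supp_A M ⊆ V(𝔞). Then M is 𝔞-cofinite if and only if H^0(x,M) and H^1(x,M) are finitely generated. -/

import Mathlib

open CategoryTheory Limits

noncomputable section

variable {A : Type} [CommRing A]

/-- The `i`-th term of the Koszul cochain complex `Hom_A(K_•(x), M)`. -/
abbrev KoszulCochain {t : ℕ} (x : Fin t → A) (M : Type) [AddCommGroup M] [Module A M]
    (i : ℕ) : Type :=
  {s : Finset (Fin t) // s.card = i} → M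

/-- The Koszul cochain differential. -/
def koszulD {t : ℕ} (x : Fin t → A) (M : Type) [AddCommGroup M] [Module A M] (i : ℕ) :
    KoszulCochain x M i →ₗ[A] KoszulCochain x M (i + 1) :=
  LinearMap.pi fun s => ∑ j ∈ s.1.attach,
    (((-1 : A) ^ ((s.1.filter (fun k => k < j.1)).card)) * x j.1) •
      (LinearMap.proj
        (⟨s.1.erase j.1, by simp [Finset.card_erase_of_mem j.2, s.2]⟩ :
          {s : Finset (Fin t) // s.card = i}) :
        KoszulCochain x M i →ₗ[A] M)

/-- The boundaries in degree `i` of the Koszul cochain complex. -/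
def koszulBoundary {t : ℕ} (x : Fin t → A) (M : Type) [AddCommGroup M] [Module A M] :
    (i : ℕ) → Submodule A (KoszulCochain x M i)
  | 0 => ⊥
  | j + 1 => LinearMap.range (koszulD x M j)

/-- The `i`-th Koszul cohomology `H^i(x, M)` of `M` with respect to `x`. -/
abbrev KoszulCohomology {t : ℕ} (x : Fin t → A) (M : Type) [AddCommGroup M] [Module A M]
    (i : ℕ) : Type :=
  LinearMap.ker (koszulD x M i) ⧸
    (koszulBoundary x M i).comap (LinearMap.ker (koszulD x M i)).subtype

/-- `Ext_A^i(A/𝔞, M)` as an `A`-module. -/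
abbrev extQuot (𝔞 : Ideal A) (M : Type) [AddCommGroup M] [Module A M] (i : ℕ) : Type :=
  ↥(((_root_.Ext A (ModuleCat A) i).obj
    (Opposite.op (ModuleCat.of A (A ⧸ 𝔞)))).obj (ModuleCat.of A M))

/-- `M` is an `𝔞`-cofinite `A`-module: `Supp M ⊆ V(𝔞)` and all `Ext_A^i(A/𝔞, M)`
are finitely generated. -/
def IsCofinite (𝔞 : Ideal A) (M : Type) [AddCommGroup M] [Module A M] : Prop :=
  Module.support A M ⊆ PrimeSpectrum.zeroLocus (𝔞 : Set A) ∧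
    ∀ i : ℕ, Module.Finite A (extQuot 𝔞 M i)

/-- A localized version of the descending chain condition. -/
def SArt (S : Submonoid A) (M : Type) [AddCommGroup M] [Module A M] : Prop :=
  ∀ N : ℕ → Submodule A M, Antitone N →
    ∃ n₀, ∀ n, n₀ ≤ n → ∀ y ∈ N n₀, ∃ s ∈ S, s • y ∈ N n

lemma SArt.of_injective {S : Submonoid A} {M₁ M₂ : Type} [AddCommGroup M₁] [Module A M₁]
    [AddCommGroup M₂] [Module A M₂] (f : M₁ →ₗ[A] M₂) (hf : Function.Injective f)
    (h : SArt S M₂) : SArt S M₁ := by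
  intro N hN
  obtain ⟨n₀, h0⟩ := h (fun n => (N n).map f) (fun i j hij => Submodule.map_mono (hN hij))
  refine ⟨n₀, fun n hn y hy => ?_⟩
  obtain ⟨s, hs, z, hz, hzy⟩ := h0 n hn (f y) ⟨y, hy, rfl⟩
  refine ⟨s, hs, ?_⟩
  rw [← map_smul] at hzy
  rwa [← hf hzy]

lemma SArt.of_exact {S : Submonoid A} {M₁ M₂ M₃ : Type} [AddCommGroup M₁] [Module A M₁]
    [AddCommGroup M₂] [Module A M₂] [AddCommGroup M₃] [Module A M₃]
    (f : M₁ →ₗ[A] M₂) (g : M₂ →ₗ[A] M₃) (hfg : Function.Exact f g)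
    (h₁ : SArt S M₁) (h₃ : SArt S M₃) : SArt S M₂ := by
  intro N hN
  obtain ⟨a, ha⟩ := h₁ (fun n => (N n).comap f) (fun i j hij => Submodule.comap_mono (hN hij))
  obtain ⟨b, hb⟩ := h₃ (fun n => (N n).map g) (fun i j hij => Submodule.map_mono (hN hij))
  refine ⟨max a b, fun n hn y hy => ?_⟩
  obtain ⟨s, hs, z, hz, hzy⟩ := hb n (le_trans (le_max_right _ _) hn) (g y)
    ⟨y, hN (le_max_right _ _) hy, rfl⟩
  have h0 : g (s • y - z) = 0 := by simp [hzy]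
  obtain ⟨w, hw⟩ := (hfg _).1 h0
  have hw' : w ∈ (N a).comap f := by
    show f w ∈ N a
    rw [hw]
    exact (N a).sub_mem ((N a).smul_mem _ (hN (le_max_left _ _) hy))
      (hN (le_trans (le_max_left _ _) hn) hz)
  obtain ⟨s', hs', hh⟩ := ha n (le_trans (le_max_left _ _) hn) w hw'
  refine ⟨s' * s, S.mul_mem hs' hs, ?_⟩
  have h2 : f (s' • w) ∈ N n := hh
  rw [map_smul, hw, smul_sub, smul_smul] at h2
  have := (N n).add_mem h2 ((N n).smul_mem s' hz)
  simpa using this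

/-- kernel of multiplication by `x` -/
abbrev kerMul (x : A) (M : Type) [AddCommGroup M] [Module A M] : Submodule A M :=
  LinearMap.ker (LinearMap.lsmul A M x)

/-- range of multiplication by `x` -/
abbrev rangeMul (x : A) (M : Type) [AddCommGroup M] [Module A M] : Submodule A M :=
  LinearMap.range (LinearMap.lsmul A M x)

lemma SArt.of_torsion {S : Submonoid A} {M : Type} [AddCommGroup M] [Module A M] (x : A)
    (hx : ∀ m : M, ∃ k : ℕ, x ^ k • m = 0) (h : SArt S (kerMul x M)) : SArt S M := by
  intro N hN
  let L : ℕ → ℕ → Submodule A (kerMul x M) := fun k n =>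
    ((N n).map (LinearMap.lsmul A M (x ^ k))).comap (kerMul x M).subtype
  have memL : ∀ k n (y : kerMul x M), y ∈ L k n ↔ ∃ z ∈ N n, x ^ k • z = (y : M) := by
    intro k n y
    rfl
  have hL : ∀ k k' n n', k ≤ k' → n ≤ n' → L k' n' ≤ L k n := by
    intro k k' n n' hk hn y hy
    rw [memL] at hy ⊢
    obtain ⟨z, hz, hzy⟩ := hy
    refine ⟨x ^ (k' - k) • z, (N n).smul_mem _ (hN hn hz), ?_⟩
    rw [smul_smul, ← pow_add, ← hzy]
    congr 2
    omega
  obtain ⟨d, hd⟩ := h (fun n => L n n) (fun i j hij => hL _ _ _ _ hij hij)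
  have hk : ∀ k, ∃ n₀, ∀ n, n₀ ≤ n → ∀ y ∈ L k n₀, ∃ s ∈ S, s • y ∈ L k n :=
    fun k => h (fun n => L k n) (fun i j hij => hL _ _ _ _ le_rfl hij)
  choose c hc using hk
  let n₁ := max d ((Finset.range d).sup c)
  have key : ∀ k n, n₁ ≤ n → ∀ y ∈ L k n₁, ∃ s ∈ S, s • y ∈ L k n := by
    intro k n hn y hy
    by_cases hkd : k < d
    · have h1 : c k ≤ n₁ :=
        le_trans (Finset.le_sup (f := c) (Finset.mem_range.2 hkd)) (le_max_right _ _)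
      exact hc k n (h1.trans hn) y (hL _ _ _ _ le_rfl h1 hy)
    · push Not at hkd
      have h1 : d ≤ n₁ := le_max_left _ _
      obtain ⟨s, hs, h2⟩ := hd (max k n) (hkd.trans (le_max_left _ _)) y (hL _ _ _ _ hkd h1 hy)
      exact ⟨s, hs, hL _ _ _ _ (le_max_left _ _) (le_max_right _ _) h2⟩
  refine ⟨n₁, fun n hn => ?_⟩
  have main : ∀ j : ℕ, ∀ y ∈ N n₁, x ^ j • y = 0 → ∃ s ∈ S, s • y ∈ N n := by
    intro j
    induction j with
    | zero =>
      intro y _ h0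
      refine ⟨1, S.one_mem, ?_⟩
      simp at h0
      simp [h0]
    | succ j ih =>
      intro y hy h0
      have hker : x ^ j • y ∈ kerMul x M := by
        simp only [LinearMap.mem_ker, LinearMap.lsmul_apply]
        rw [smul_smul, ← pow_succ', h0]
      obtain ⟨s, hs, h1⟩ := key j n hn ⟨x ^ j • y, hker⟩ ((memL _ _ _).2 ⟨y, hy, rfl⟩)
      rw [memL] at h1
      obtain ⟨z, hz, hzy⟩ := h1
      have hzy' : x ^ j • z = s • x ^ j • y := hzy
      obtain ⟨s', hs', h2⟩ := ih (s • y - z)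
        ((N n₁).sub_mem ((N n₁).smul_mem _ hy) (hN hn hz))
        (by rw [smul_sub, hzy', smul_comm, sub_self])
      refine ⟨s' * s, S.mul_mem hs' hs, ?_⟩
      rw [smul_sub, smul_smul] at h2
      simpa using (N n).add_mem h2 ((N n).smul_mem s' hz)
  intro y hy
  obtain ⟨k, hk⟩ := hx y
  exact main k y hy hk

/-- the submodule killed by all `x i` -/
def kilX {t : ℕ} (x : Fin t → A) (M : Type) [AddCommGroup M] [Module A M] : Submodule A M where
  carrier := {m | ∀ i, x i • m = 0}
  add_mem' := by intro a b ha hb i; rw [smul_add, ha i, hb i, add_zero]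
  zero_mem' := by intro i; simp
  smul_mem' := by intro c m hm i; rw [smul_comm, hm i, smul_zero]

lemma mem_kilX {t : ℕ} (x : Fin t → A) (M : Type) [AddCommGroup M] [Module A M] (m : M) :
    m ∈ kilX x M ↔ ∀ i, x i • m = 0 := Iff.rfl

lemma mem_kilX' {t : ℕ} (x : Fin t → A) (M : Type) [AddCommGroup M] [Module A M] (m : M) :
    m ∈ kilX x M ↔ ∀ r ∈ Ideal.span (Set.range x), r • m = 0 := by
  constructor
  · intro h r hr
    induction hr using Submodule.span_induction with
    | mem r hr => obtain ⟨i, rfl⟩ := hr; exact h i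
    | zero => simp
    | add a b _ _ ha hb => rw [add_smul, ha, hb, add_zero]
    | smul c a _ ha => rw [smul_eq_mul, mul_smul, ha, smul_zero]
  · intro h i
    exact h _ (Ideal.subset_span ⟨i, rfl⟩)

/-- map induced on the killed part -/
def kilXMap {t : ℕ} (x : Fin t → A) {M M' : Type} [AddCommGroup M] [Module A M]
    [AddCommGroup M'] [Module A M'] (f : M →ₗ[A] M') : kilX x M →ₗ[A] kilX x M' :=
  f.restrict (by intro m hm i; rw [← map_smul, hm i, map_zero])

lemma kilXMap_inj {t : ℕ} (x : Fin t → A) {M M' : Type} [AddCommGroup M] [Module A M]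
    [AddCommGroup M'] [Module A M'] (f : M →ₗ[A] M') (hf : Function.Injective f) :
    Function.Injective (kilXMap x f) := by
  intro a b h
  have := congrArg Subtype.val h
  exact Subtype.ext (hf this)

lemma SArt.of_kilX {S : Submonoid A} {t : ℕ} (x : Fin t → A) (T : Finset (Fin t)) :
    ∀ (M : Type) [AddCommGroup M] [Module A M],
    (∀ (m : M) i, ∃ k : ℕ, x i ^ k • m = 0) → (∀ i ∉ T, ∀ m : M, x i • m = 0) →
    SArt S (kilX x M) → SArt S M := by
  induction T using Finset.induction_on with
  | empty =>
    intro M _ _ _ hk h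
    let f : M →ₗ[A] kilX x M := LinearMap.codRestrict _ LinearMap.id
      (fun m i => hk i (Finset.notMem_empty i) m)
    exact h.of_injective f (fun a b hab => congrArg Subtype.val hab)
  | insert j T hj ih =>
    intro M _ _ htor hk h
    refine SArt.of_torsion (x j) (fun m => htor m j) (ih _ ?_ ?_ ?_)
    · intro m i
      obtain ⟨k, hk⟩ := htor m i
      exact ⟨k, Subtype.ext (by simpa using hk)⟩
    · intro i hi m
      by_cases hij : i = j
      · subst hij
        exact Subtype.ext m.2
      · exact Subtype.ext (hk i (by simp [hij, hi]) m)
    · exact h.of_injective (kilXMap x (Submodule.subtype _))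
        (kilXMap_inj _ _ (Submodule.injective_subtype _))

/-- complement of the union of minimal primes -/
def minS (𝔞 : Ideal A) : Submonoid A where
  carrier := {s | ∀ p ∈ 𝔞.minimalPrimes, s ∉ p}
  one_mem' := fun p hp h => hp.1.1.ne_top ((Ideal.eq_top_iff_one p).2 h)
  mul_mem' := fun ha hb p hp h => (hp.1.1.mem_or_mem h).elim (ha p hp) (hb p hp)

lemma exists_minS [IsNoetherianRing A] (𝔞 : Ideal A) (J : Ideal A)
    (hJ : ∀ p ∈ 𝔞.minimalPrimes, ¬ J ≤ p) : ∃ s ∈ J, s ∈ minS 𝔞 := by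
  by_contra hcon
  push Not at hcon
  have hfin := Ideal.finite_minimalPrimes_of_isNoetherianRing A 𝔞
  have := (J.subset_union_prime_finite hfin (f := id) 0 0 fun p h _ _ ↦ h.1.1).1 (by
    intro s hs
    have := hcon s hs
    simp only [minS, Submonoid.mem_mk, Subsemigroup.mem_mk] at this
    by_contra h'
    apply this
    intro p hp hsp
    apply h'
    simp only [Set.mem_iUnion]
    exact ⟨p, hp, hsp⟩)
  obtain ⟨p, hp, hle⟩ := this
  exact hJ p hp hle

lemma sart_finite [IsNoetherianRing A] (𝔞 : Ideal A) (W : Type) [AddCommGroup W] [Module A W]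
    (hW : Module.Finite A W) (hk : ∀ r ∈ 𝔞, ∀ w : W, r • w = 0) : SArt (minS 𝔞) W := by
  revert hk
  induction hW using IsNoetherianRing.induction_on_isQuotientEquivQuotientPrime A with
  | subsingleton N =>
    intro _ N _
    refine ⟨0, fun n _ y _ => ⟨1, one_mem _, ?_⟩⟩
    rw [Subsingleton.elim (1 • y) 0]
    exact zero_mem _
  | quotient N p f =>
    intro hk
    refine SArt.of_injective f.toLinearMap f.injective ?_
    have hap : 𝔞 ≤ p.1 := by
      intro r hr
      have := hk r hr (f.symm (Ideal.Quotient.mk _ 1))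
      have := congrArg f this
      rw [map_smul, map_zero, LinearEquiv.apply_symm_apply] at this
      rw [← Ideal.Quotient.eq_zero_iff_mem, ← this, Algebra.smul_def]
      simp
    have hgen : ∀ s ∈ minS 𝔞, ∀ K : Submodule A (A ⧸ p.1), (Ideal.Quotient.mk p.1 s) ∈ K →
        ∀ y, s • y ∈ K := by
      intro s _ K hs y
      obtain ⟨y, rfl⟩ := Ideal.Quotient.mk_surjective y
      have : s • (Ideal.Quotient.mk p.1 y) = y • (Ideal.Quotient.mk p.1 s) := by
        rw [Algebra.smul_def, Algebra.smul_def]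
        exact mul_comm _ _
      rw [this]
      exact K.smul_mem _ hs
    intro K hK
    by_cases hz : ∃ n₀, K n₀ = ⊥
    · obtain ⟨n₀, h0⟩ := hz
      refine ⟨n₀, fun n _ y hy => ⟨1, one_mem _, ?_⟩⟩
      rw [h0, Submodule.mem_bot] at hy
      simp [hy]
    · push Not at hz
      refine ⟨0, fun n _ y _ => ?_⟩
      obtain ⟨w, hw, hw0⟩ := (K n).ne_bot_iff.1 (hz n)
      let J : Ideal A := (K n).comap (Algebra.linearMap A (A ⧸ p.1))
      have hpJ : p.1 ≤ J := by
        intro r hr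
        show Ideal.Quotient.mk p.1 r ∈ K n
        rw [Ideal.Quotient.eq_zero_iff_mem.2 hr]
        exact zero_mem _
      obtain ⟨w, rfl⟩ := Ideal.Quotient.mk_surjective w
      obtain ⟨s, hs, hsS⟩ := exists_minS 𝔞 J (by
        intro q hq hJq
        have h1 : q ≤ p.1 := hq.2 ⟨p.2, hap⟩ (hpJ.trans hJq)
        have h2 : w ∈ J := hw
        exact hw0 (Ideal.Quotient.eq_zero_iff_mem.2 (h1 (hJq h2))))
      exact ⟨s, hsS, hgen s hsS _ hs y⟩
  | exact N₁ N₂ N₃ f g hf hg hfg h₁ h₃ =>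
    intro hk
    refine SArt.of_exact f g hfg (h₁ ?_) (h₃ ?_)
    · intro r hr w
      apply hf
      rw [map_smul, hk r hr, map_zero]
    · intro r hr w
      obtain ⟨w, rfl⟩ := hg w
      rw [← map_smul, hk r hr, map_zero]

lemma sart_bot_finite [IsNoetherianRing A] (𝔞 : Ideal A) (hdim : ringKrullDim (A ⧸ 𝔞) = 1)
    (W : Type) [AddCommGroup W] [Module A W]
    (hW : Module.Finite A W) (hk : ∀ r ∈ 𝔞, ∀ w : W, r • w = 0)
    (ht : ∀ w : W, ∃ s ∈ minS 𝔞, s • w = 0) : SArt (⊥ : Submonoid A) W := by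
  revert hk ht
  induction hW using IsNoetherianRing.induction_on_isQuotientEquivQuotientPrime A with
  | subsingleton N =>
    intro _ _ N _
    refine ⟨0, fun n _ y _ => ⟨1, one_mem _, ?_⟩⟩
    rw [Subsingleton.elim (1 • y) 0]
    exact zero_mem _
  | quotient N p f =>
    intro hk ht
    refine SArt.of_injective f.toLinearMap f.injective ?_
    have hmem : ∀ r, r • (f.symm (Ideal.Quotient.mk _ 1)) = 0 → r ∈ p.1 := by
      intro r this
      have := congrArg f this
      rw [map_smul, map_zero, LinearEquiv.apply_symm_apply] at this
      rw [← Ideal.Quotient.eq_zero_iff_mem, ← this, Algebra.smul_def]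
      simp
    have hap : 𝔞 ≤ p.1 := fun r hr => hmem r (hk r hr _)
    obtain ⟨s, hs, hs0⟩ := ht (f.symm (Ideal.Quotient.mk _ 1))
    have hsp := hmem s hs0
    have hp := p.2
    have hpmax : p.1.IsMaximal := by
      have hle : Ring.KrullDimLE 1 (A ⧸ 𝔞) := Ring.krullDimLE_iff.2 (by simp [hdim])
      have hprime : (p.1.map (Ideal.Quotient.mk 𝔞)).IsPrime :=
        Ideal.map_isPrime_of_surjective Ideal.Quotient.mk_surjective (by simpa using hap)
      have hcomap : (p.1.map (Ideal.Quotient.mk 𝔞)).comap (Ideal.Quotient.mk 𝔞) = p.1 := by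
        rw [Ideal.comap_map_of_surjective _ Ideal.Quotient.mk_surjective]
        simpa [← RingHom.ker_eq_comap_bot] using hap
      rcases Ring.krullDimLE_one_iff.1 hle _ hprime with h | h
      · exfalso
        refine hs p.1 ⟨⟨p.2, hap⟩, ?_⟩ hsp
        intro q hq hqp
        have hqprime : (q.map (Ideal.Quotient.mk 𝔞)).IsPrime := by
          have := hq.1
          exact Ideal.map_isPrime_of_surjective Ideal.Quotient.mk_surjective (by simpa using hq.2)
        have hle2 := h.2 ⟨hqprime, bot_le⟩ (Ideal.map_mono hqp)
        have := Ideal.comap_mono (f := Ideal.Quotient.mk 𝔞) hle2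
        rw [hcomap, Ideal.comap_map_of_surjective _ Ideal.Quotient.mk_surjective] at this
        simpa [← RingHom.ker_eq_comap_bot, sup_eq_left.2 hq.2] using this
      · rw [← hcomap]
        exact Ideal.comap_isMaximal_of_surjective _ Ideal.Quotient.mk_surjective
    intro K hK
    by_cases hz : ∃ n₀, K n₀ = ⊥
    · obtain ⟨n₀, h0⟩ := hz
      refine ⟨n₀, fun n _ y hy => ⟨1, one_mem _, ?_⟩⟩
      rw [h0, Submodule.mem_bot] at hy
      simp [hy]
    · push Not at hz
      refine ⟨0, fun n _ y _ => ⟨1, one_mem _, ?_⟩⟩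
      obtain ⟨w, hw, hw0⟩ := (K n).ne_bot_iff.1 (hz n)
      obtain ⟨w, rfl⟩ := Ideal.Quotient.mk_surjective w
      obtain ⟨y, rfl⟩ := Ideal.Quotient.mk_surjective y
      obtain ⟨v, hv⟩ := hpmax.exists_inv (fun h => hw0 (Ideal.Quotient.eq_zero_iff_mem.2 h))
      obtain ⟨i, hi, hv⟩ := hv
      have : (Ideal.Quotient.mk p.1 y) = (y * v) • Ideal.Quotient.mk p.1 w := by
        rw [Algebra.smul_def, Ideal.Quotient.algebraMap_eq, ← map_mul, Ideal.Quotient.eq]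
        have : y - y * v * w = y * i := by linear_combination (-y) * hv
        rw [this]
        exact Ideal.mul_mem_left _ _ hi
      rw [one_smul, this]
      exact (K n).smul_mem _ hw
  | exact N₁ N₂ N₃ f g hf hg hfg h₁ h₃ =>
    intro hk ht
    refine SArt.of_exact f g hfg (h₁ ?_ ?_) (h₃ ?_ ?_)
    · intro r hr w
      apply hf
      rw [map_smul, hk r hr, map_zero]
    · intro w
      obtain ⟨s, hs, h⟩ := ht (f w)
      exact ⟨s, hs, hf (by rw [map_smul, h, map_zero])⟩
    · intro r hr w
      obtain ⟨w, rfl⟩ := hg w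
      rw [← map_smul, hk r hr, map_zero]
    · intro w
      obtain ⟨w, rfl⟩ := hg w
      obtain ⟨s, hs, h⟩ := ht w
      exact ⟨s, hs, by rw [← map_smul, h, map_zero]⟩


lemma noeth_mid {M₁ M₂ M₃ : Type*} [AddCommGroup M₁] [Module A M₁]
    [AddCommGroup M₂] [Module A M₂] [AddCommGroup M₃] [Module A M₃]
    (f : M₁ →ₗ[A] M₂) (g : M₂ →ₗ[A] M₃) (h : ∀ y, g y = 0 → ∃ z, f z = y)
    (h₁ : IsNoetherian A M₁) (h₃ : IsNoetherian A M₃) : IsNoetherian A M₂ := by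
  have hk : IsNoetherian A (LinearMap.range f) :=
    isNoetherian_of_surjective f.rangeRestrict (LinearMap.range_rangeRestrict f)
  have hk2 : IsNoetherian A (LinearMap.ker g) :=
    isNoetherian_of_le (show LinearMap.ker g ≤ LinearMap.range f from fun y hy => h y hy)
  exact isNoetherian_of_range_eq_ker (LinearMap.ker g).subtype g (by simp)

/-- Finiteness of `Ext^i(A/𝔞, M)`. -/
def EF (𝔞 : Ideal A) (M : Type) [AddCommGroup M] [Module A M] (i : ℕ) : Prop :=
  IsNoetherian A (CategoryTheory.Abelian.Ext (ModuleCat.of A (A ⧸ 𝔞)) (ModuleCat.of A M) i)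

section LES
variable (𝔞 : Ideal A) {M₁ M₂ M₃ : Type} [AddCommGroup M₁] [Module A M₁]
    [AddCommGroup M₂] [Module A M₂] [AddCommGroup M₃] [Module A M₃]
    (f : M₁ →ₗ[A] M₂) (g : M₂ →ₗ[A] M₃)

/-- the short complex -/
abbrev scOf (hfg : Function.Exact f g) : ShortComplex (ModuleCat A) :=
  ShortComplex.mk (ModuleCat.ofHom f) (ModuleCat.ofHom g) (by
    ext x
    exact hfg.apply_apply_eq_zero x)

lemma scOf_shortExact (hf : Function.Injective f)
    (hg : Function.Surjective g) (hfg : Function.Exact f g) : (scOf f g hfg).ShortExact where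
  exact := (ShortComplex.ShortExact.moduleCat_exact_iff_function_exact _).2 hfg
  mono_f := (ModuleCat.mono_iff_injective _).2 hf
  epi_g := (ModuleCat.epi_iff_surjective _).2 hg

/-- functoriality of Ext in the second argument -/
def extMap (i : ℕ) : CategoryTheory.Abelian.Ext (ModuleCat.of A (A ⧸ 𝔞)) (ModuleCat.of A M₁) i →ₗ[A]
    CategoryTheory.Abelian.Ext (ModuleCat.of A (A ⧸ 𝔞)) (ModuleCat.of A M₂) i :=
  (CategoryTheory.Abelian.Ext.mk₀ (ModuleCat.ofHom f)).postcompOfLinear A _ (add_zero i)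

lemma extMap_apply (i : ℕ) (z) : extMap 𝔞 f i z =
    z.comp (CategoryTheory.Abelian.Ext.mk₀ (ModuleCat.ofHom f)) (add_zero i) := rfl

lemma ext_exact_mid (hf : Function.Injective f) (hg : Function.Surjective g)
    (hfg : Function.Exact f g) (i : ℕ) (z) (hz : extMap 𝔞 g i z = 0) : ∃ w, extMap 𝔞 f i w = z :=
  CategoryTheory.Abelian.Ext.covariant_sequence_exact₂ _ (scOf_shortExact f g hf hg hfg) z hz

/-- connecting map -/
def extDelta (i : ℕ) (hf : Function.Injective f)
    (hg : Function.Surjective g) (hfg : Function.Exact f g) :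
    CategoryTheory.Abelian.Ext (ModuleCat.of A (A ⧸ 𝔞)) (ModuleCat.of A M₃) i →ₗ[A]
    CategoryTheory.Abelian.Ext (ModuleCat.of A (A ⧸ 𝔞)) (ModuleCat.of A M₁) (i + 1) :=
  (scOf_shortExact f g hf hg hfg).extClass.postcompOfLinear A _ rfl

lemma ext_exact_right (hf : Function.Injective f) (hg : Function.Surjective g)
    (hfg : Function.Exact f g) (i : ℕ) (z) (hz : extDelta 𝔞 f g i hf hg hfg z = 0) :
    ∃ w, extMap 𝔞 g i w = z :=
  CategoryTheory.Abelian.Ext.covariant_sequence_exact₃ _ (scOf_shortExact f g hf hg hfg) z rfl hz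

lemma ext_exact_left (hf : Function.Injective f) (hg : Function.Surjective g)
    (hfg : Function.Exact f g) (i : ℕ) (z) (hz : extMap 𝔞 f (i + 1) z = 0) :
    ∃ w, extDelta 𝔞 f g i hf hg hfg w = z :=
  CategoryTheory.Abelian.Ext.covariant_sequence_exact₁ _ (scOf_shortExact f g hf hg hfg) z hz rfl

lemma EF.mid (hf : Function.Injective f) (hg : Function.Surjective g)
    (hfg : Function.Exact f g) (i : ℕ) (h₁ : EF 𝔞 M₁ i) (h₃ : EF 𝔞 M₃ i) : EF 𝔞 M₂ i :=
  noeth_mid _ _ (ext_exact_mid 𝔞 f g hf hg hfg i) h₁ h₃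

lemma EF.right (hf : Function.Injective f) (hg : Function.Surjective g)
    (hfg : Function.Exact f g) (i : ℕ) (h₁ : EF 𝔞 M₂ i) (h₃ : EF 𝔞 M₁ (i + 1)) : EF 𝔞 M₃ i :=
  noeth_mid _ _ (ext_exact_right 𝔞 f g hf hg hfg i) h₁ h₃

lemma EF.left (hf : Function.Injective f) (hg : Function.Surjective g)
    (hfg : Function.Exact f g) (i : ℕ) (h₁ : EF 𝔞 M₃ i) (h₃ : EF 𝔞 M₂ (i + 1)) : EF 𝔞 M₁ (i + 1) :=
  noeth_mid _ _ (ext_exact_left 𝔞 f g hf hg hfg i) h₁ h₃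

lemma EF.sub (hf : Function.Injective f) (h : EF 𝔞 M₂ 0) : EF 𝔞 M₁ 0 := by
  have : Mono (ModuleCat.ofHom f) := (ModuleCat.mono_iff_injective _).2 hf
  unfold EF at h
  exact isNoetherian_of_injective (extMap 𝔞 f 0)
    (CategoryTheory.Abelian.Ext.postcomp_mk₀_injective_of_mono _ _)

lemma ext_smul_zero (i : ℕ) (x : A) (hx : x ∈ 𝔞) (z : CategoryTheory.Abelian.Ext
    (ModuleCat.of A (A ⧸ 𝔞)) (ModuleCat.of A M₁) i) : x • z = 0 := by
  have h : x • 𝟙 (ModuleCat.of A (A ⧸ 𝔞)) = 0 := by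
    apply ModuleCat.hom_ext
    apply LinearMap.ext
    intro w
    obtain ⟨w, rfl⟩ := Ideal.Quotient.mk_surjective w
    show x • Ideal.Quotient.mk 𝔞 w = 0
    rw [Algebra.smul_def, Ideal.Quotient.algebraMap_eq, ← map_mul, Ideal.Quotient.eq_zero_iff_mem]
    exact Ideal.mul_mem_right _ _ hx
  rw [← CategoryTheory.Abelian.Ext.mk₀_id_comp z, ← CategoryTheory.Abelian.Ext.smul_comp,
    ← CategoryTheory.Abelian.Ext.mk₀_smul, h, CategoryTheory.Abelian.Ext.mk₀_zero,
    CategoryTheory.Abelian.Ext.zero_comp]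

end LES

lemma EF.of_finite [IsNoetherianRing A] (𝔞 : Ideal A) (M : Type) [AddCommGroup M] [Module A M]
    [Module.Finite A M] (i : ℕ) : EF 𝔞 M i := by
  have : Module.Finite A (CategoryTheory.Abelian.Ext (ModuleCat.of A (A ⧸ 𝔞)) (ModuleCat.of A M) i)
    := ModuleCat.finite_ext A (ModuleCat.of A (A ⧸ 𝔞)) (ModuleCat.of A M) i
  exact isNoetherian_of_isNoetherianRing_of_finite A _

section mul
variable (x : A) (M : Type) [AddCommGroup M] [Module A M]

/-- `M → xM` -/
abbrev toRange : M →ₗ[A] rangeMul x M := (LinearMap.lsmul A M x).rangeRestrict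

lemma toRange_surj : Function.Surjective (toRange x M) := LinearMap.surjective_rangeRestrict _

lemma ker_exact : Function.Exact (kerMul x M).subtype (toRange x M) := by
  intro m
  simp [Subtype.ext_iff]

lemma range_exact : Function.Exact (rangeMul x M).subtype (rangeMul x M).mkQ := by
  intro m
  simp

lemma EF.mul (𝔞 : Ideal A) (hx : x ∈ 𝔞) (i : ℕ) (h₁ : EF 𝔞 (kerMul x M) (i + 1))
    (h₂ : EF 𝔞 (M ⧸ rangeMul x M) i) : EF 𝔞 M (i + 1) := by
  let p := extMap 𝔞 (toRange x M) (i + 1)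
  let q := extMap 𝔞 (rangeMul x M).subtype (i + 1)
  have hqp : ∀ z, q (p z) = 0 := by
    intro z
    have h0 := ext_smul_zero 𝔞 (i + 1) x hx z
    rw [CategoryTheory.Abelian.Ext.smul_eq_comp_mk₀] at h0
    simp only [p, q, extMap_apply]
    rw [CategoryTheory.Abelian.Ext.comp_assoc_of_third_deg_zero,
      CategoryTheory.Abelian.Ext.mk₀_comp_mk₀]
    exact h0
  have hk : IsNoetherian A (LinearMap.ker q) := by
    have h₂' : IsNoetherian A (LinearMap.range (extDelta 𝔞 _ _ i
        (rangeMul x M).injective_subtype (rangeMul x M).mkQ_surjective (range_exact x M))) := by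
      unfold EF at h₂
      exact isNoetherian_of_surjective (LinearMap.rangeRestrict _) (LinearMap.range_rangeRestrict _)
    refine isNoetherian_of_le (s := LinearMap.ker q) (t := _) (ht := h₂') ?_
    intro z hz
    exact ext_exact_left 𝔞 _ _ (rangeMul x M).injective_subtype
      (rangeMul x M).mkQ_surjective (range_exact x M) i z hz
  refine noeth_mid (extMap 𝔞 (kerMul x M).subtype (i + 1)) (p.codRestrict (LinearMap.ker q) hqp)
    ?_ h₁ hk
  intro y hy
  exact ext_exact_mid 𝔞 _ _ (kerMul x M).injective_subtype (toRange_surj x M) (ker_exact x M)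
    (i + 1) y (congrArg Subtype.val hy)

end mul


/-- evaluation at one -/
def evalOne {t : ℕ} (x : Fin t → A) (M : Type) [AddCommGroup M] [Module A M] :
    ((A ⧸ Ideal.span (Set.range x)) →ₗ[A] M) →ₗ[A] kilX x M :=
  LinearMap.codRestrict _ (LinearMap.applyₗ (1 : A ⧸ Ideal.span (Set.range x))) (by
    intro φ i
    show x i • φ 1 = 0
    rw [← map_smul]
    have : x i • (1 : A ⧸ Ideal.span (Set.range x)) = 0 := by
      rw [Algebra.smul_def, mul_one, Ideal.Quotient.algebraMap_eq, Ideal.Quotient.eq_zero_iff_mem]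
      exact Ideal.subset_span ⟨i, rfl⟩
    rw [this, map_zero])

lemma evalOne_bij {t : ℕ} (x : Fin t → A) (M : Type) [AddCommGroup M] [Module A M] :
    Function.Bijective (evalOne x M) := by
  constructor
  · intro φ ψ h
    have h1 : φ 1 = ψ 1 := congrArg Subtype.val h
    apply LinearMap.ext
    intro w
    obtain ⟨w, rfl⟩ := Ideal.Quotient.mk_surjective w
    have : Ideal.Quotient.mk (Ideal.span (Set.range x)) w = w • 1 := by
      rw [Algebra.smul_def, mul_one, Ideal.Quotient.algebraMap_eq]
    rw [this, map_smul, map_smul, h1]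
  · intro m
    have h : Ideal.span (Set.range x) ≤ LinearMap.ker (LinearMap.toSpanSingleton A M m.1) :=
      fun r hr => (mem_kilX' x M m.1).1 m.2 r hr
    refine ⟨Submodule.liftQ (Ideal.span (Set.range x)) (LinearMap.toSpanSingleton A M m.1) h, ?_⟩
    apply Subtype.ext
    exact (Submodule.liftQ_apply (Ideal.span (Set.range x)) (h := h)
      (LinearMap.toSpanSingleton A M m.1) (1:A)).trans (by simp)

lemma EF_zero_iff {t : ℕ} (x : Fin t → A) (M : Type) [AddCommGroup M] [Module A M] :
    EF (Ideal.span (Set.range x)) M 0 ↔ IsNoetherian A (kilX x M) := by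
  let e : CategoryTheory.Abelian.Ext (ModuleCat.of A (A ⧸ Ideal.span (Set.range x)))
      (ModuleCat.of A M) 0 ≃ₗ[A] kilX x M :=
    (CategoryTheory.Abelian.Ext.linearEquiv₀.trans ModuleCat.homLinearEquiv).trans
      (LinearEquiv.ofBijective (evalOne x M) (evalOne_bij x M))
  exact ⟨fun h => by unfold EF at h; exact isNoetherian_of_linearEquiv e,
    fun h => by unfold EF; exact isNoetherian_of_linearEquiv e.symm⟩

lemma stepK (𝔞 : Ideal A) (x : A) (hx : x ∈ 𝔞) (S : Submonoid A)
    (G : ∀ (M : Type) [AddCommGroup M] [Module A M], Prop)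
    (hker : ∀ (M : Type) [AddCommGroup M] [Module A M], G M → ∀ i, EF 𝔞 (kerMul x M) i)
    (hrange : ∀ (M : Type) [AddCommGroup M] [Module A M], G M → G (rangeMul x M))
    (hbase : ∀ (M : Type) [AddCommGroup M] [Module A M], G M →
      (∀ m : M, ∃ s ∈ S, ∃ m' : M, s • m = x • m') → ∀ i, EF 𝔞 (M ⧸ rangeMul x M) i)
    (hzero : ∀ (M : Type) [AddCommGroup M] [Module A M], G M → EF 𝔞 M 0) (k : ℕ) :
    ∀ (M : Type) [AddCommGroup M] [Module A M], G M →
      (∀ m : M, ∃ s ∈ S, ∃ m' : M, s • x ^ k • m = x ^ (k + 1) • m') → ∀ i, EF 𝔞 M i := by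
  induction k with
  | zero =>
    intro M _ _ hG h i
    have h' : ∀ m : M, ∃ s ∈ S, ∃ m' : M, s • m = x • m' := by simpa using h
    cases i with
    | zero => exact hzero M hG
    | succ i => exact EF.mul x M 𝔞 hx i (hker M hG _) (hbase M hG h' i)
  | succ k ih =>
    intro M _ _ hG h i
    refine EF.mid 𝔞 _ _ (kerMul x M).injective_subtype (toRange_surj x M) (ker_exact x M) i
      (hker M hG i) (ih _ (hrange M hG) ?_ i)
    rintro ⟨_, m, rfl⟩
    obtain ⟨s, hs, m', hm⟩ := h m
    refine ⟨s, hs, ⟨x • m', m', rfl⟩, Subtype.ext ?_⟩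
    show s • x ^ k • x • m = x ^ (k + 1) • x • m'
    rw [smul_smul (x ^ k), ← pow_succ, hm, smul_smul, ← pow_succ]

lemma rangeMul_antitone (x : A) (M : Type) [AddCommGroup M] [Module A M] :
    Antitone (fun k : ℕ => rangeMul (x ^ k) M) := by
  intro i j hij
  rintro _ ⟨m, rfl⟩
  refine ⟨x ^ (j - i) • m, ?_⟩
  simp only [LinearMap.lsmul_apply]
  rw [smul_smul, ← pow_add]
  congr 2
  omega

lemma SArt.exists_k {S : Submonoid A} {M : Type} [AddCommGroup M] [Module A M] (x : A)
    (h : SArt S M) :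
    ∃ k : ℕ, ∀ m : M, ∃ s ∈ S, ∃ m' : M, s • x ^ k • m = x ^ (k + 1) • m' := by
  obtain ⟨k, hk⟩ := h _ (rangeMul_antitone x M)
  refine ⟨k, fun m => ?_⟩
  obtain ⟨s, hs, m', hm⟩ := hk (k + 1) (Nat.le_succ k) (x ^ k • m) ⟨m, rfl⟩
  exact ⟨s, hs, m', hm.symm⟩

lemma EF.all_of_killed [IsNoetherianRing A] {t : ℕ} (x : Fin t → A) (M : Type) [AddCommGroup M]
    [Module A M] (hk : ∀ i, ∀ m : M, x i • m = 0) (h0 : EF (Ideal.span (Set.range x)) M 0)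
    (i : ℕ) : EF (Ideal.span (Set.range x)) M i := by
  rw [EF_zero_iff] at h0
  let f : M →ₗ[A] kilX x M := LinearMap.codRestrict _ LinearMap.id (fun m i => hk i m)
  have : IsNoetherian A M :=
    isNoetherian_of_injective f (fun a b hab => congrArg Subtype.val hab)
  exact EF.of_finite _ M i

lemma killed_ker {t : ℕ} {x : Fin t → A} {j : Fin t} {T : Finset (Fin t)}
    {M : Type} [AddCommGroup M] [Module A M]
    (hk : ∀ i ∉ insert j T, ∀ m : M, x i • m = 0) : ∀ i ∉ T, ∀ m : kerMul (x j) M, x i • m = 0 := by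
  intro i hi m
  by_cases hij : i = j
  · subst hij
    exact Subtype.ext m.2
  · exact Subtype.ext (hk i (by simp [hij, hi]) m)

lemma art_main [IsNoetherianRing A] {t : ℕ} (x : Fin t → A) (T : Finset (Fin t)) :
    ∀ (M : Type) [AddCommGroup M] [Module A M], (∀ i ∉ T, ∀ m : M, x i • m = 0) →
    SArt (⊥ : Submonoid A) M → EF (Ideal.span (Set.range x)) M 0 →
    ∀ i, EF (Ideal.span (Set.range x)) M i := by
  induction T using Finset.induction_on with
  | empty =>
    intro M _ _ hk _ h0 i
    exact EF.all_of_killed x M (fun i => hk i (Finset.notMem_empty i)) h0 i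
  | insert j T hj ih =>
    intro M _ _ hk hA h0
    obtain ⟨k, hkk⟩ := hA.exists_k (x j)
    refine stepK (Ideal.span (Set.range x)) (x j) (Ideal.subset_span ⟨j, rfl⟩) ⊥
      (fun M _ _ => (∀ i ∉ insert j T, ∀ m : M, x i • m = 0) ∧ SArt (⊥ : Submonoid A) M ∧
        EF (Ideal.span (Set.range x)) M 0) ?_ ?_ ?_ ?_ k M ⟨hk, hA, h0⟩ hkk
    · rintro M _ _ ⟨hk, hA, h0⟩
      exact ih _ (killed_ker hk) (hA.of_injective _ (kerMul (x j) M).injective_subtype)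
        (EF.sub _ _ (kerMul (x j) M).injective_subtype h0)
    · rintro M _ _ ⟨hk, hA, h0⟩
      exact ⟨fun i hi m => Subtype.ext (hk i hi m),
        hA.of_injective _ (rangeMul (x j) M).injective_subtype,
        EF.sub _ _ (rangeMul (x j) M).injective_subtype h0⟩
    · rintro M _ _ ⟨hk, hA, h0⟩ h i
      have htop : rangeMul (x j) M = ⊤ := by
        rw [eq_top_iff]
        rintro m -
        obtain ⟨s, hs, m', hm⟩ := h m
        rw [Submonoid.mem_bot] at hs
        subst hs
        exact ⟨m', by simpa using hm.symm⟩
      have : Subsingleton (M ⧸ rangeMul (x j) M) :=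
        Submodule.Quotient.subsingleton_iff.2 htop
      exact EF.of_finite _ _ i
    · rintro M _ _ ⟨hk, hA, h0⟩
      exact h0

lemma cof_main [IsNoetherianRing A] {t : ℕ} (x : Fin t → A)
    (hdim : ringKrullDim (A ⧸ (Ideal.span (Set.range x))) = 1) (T : Finset (Fin t)) :
    ∀ (M : Type) [AddCommGroup M] [Module A M], (∀ i ∉ T, ∀ m : M, x i • m = 0) →
    (∀ (m : M) i, ∃ k : ℕ, x i ^ k • m = 0) → EF (Ideal.span (Set.range x)) M 0 →
    EF (Ideal.span (Set.range x)) M 1 → ∀ i, EF (Ideal.span (Set.range x)) M i := by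
  induction T using Finset.induction_on with
  | empty =>
    intro M _ _ hk _ h0 _ i
    exact EF.all_of_killed x M (fun i => hk i (Finset.notMem_empty i)) h0 i
  | insert j T hj ih =>
    intro M _ _ hk htor h0 h1
    have hA : SArt (minS (Ideal.span (Set.range x))) M := by
      refine SArt.of_kilX x (insert j T) M htor hk ?_
      have := (EF_zero_iff x M).1 h0
      refine sart_finite _ _ inferInstance ?_
      intro r hr w
      exact Subtype.ext ((mem_kilX' x M w.1).1 w.2 r hr)
    obtain ⟨k, hkk⟩ := hA.exists_k (x j)
    have hkerall : ∀ (M : Type) [AddCommGroup M] [Module A M],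
        (∀ i ∉ insert j T, ∀ m : M, x i • m = 0) →
        (∀ (m : M) i, ∃ k : ℕ, x i ^ k • m = 0) → EF (Ideal.span (Set.range x)) M 0 →
        EF (Ideal.span (Set.range x)) M 1 →
        ∀ i, EF (Ideal.span (Set.range x)) (kerMul (x j) M) i := by
      intro M _ _ hk htor h0 h1
      refine ih _ (killed_ker hk) ?_ (EF.sub _ _ (kerMul (x j) M).injective_subtype h0) ?_
      · intro m i
        obtain ⟨k, hk⟩ := htor m i
        exact ⟨k, Subtype.ext (by simpa using hk)⟩
      · exact EF.left _ _ _ (kerMul (x j) M).injective_subtype (toRange_surj _ M) (ker_exact _ M) 0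
          (EF.sub _ _ (rangeMul (x j) M).injective_subtype h0) h1
    have hr1 : ∀ (M : Type) [AddCommGroup M] [Module A M],
        (∀ i ∉ insert j T, ∀ m : M, x i • m = 0) →
        (∀ (m : M) i, ∃ k : ℕ, x i ^ k • m = 0) → EF (Ideal.span (Set.range x)) M 0 →
        EF (Ideal.span (Set.range x)) M 1 →
        EF (Ideal.span (Set.range x)) (rangeMul (x j) M) 1 := by
      intro M _ _ hk htor h0 h1
      exact EF.right _ _ _ (kerMul (x j) M).injective_subtype (toRange_surj _ M) (ker_exact _ M) 1
        h1 (hkerall M hk htor h0 h1 2)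
    refine stepK (Ideal.span (Set.range x)) (x j) (Ideal.subset_span ⟨j, rfl⟩)
      (minS (Ideal.span (Set.range x)))
      (fun M _ _ => (∀ i ∉ insert j T, ∀ m : M, x i • m = 0) ∧
        (∀ (m : M) i, ∃ k : ℕ, x i ^ k • m = 0) ∧
        EF (Ideal.span (Set.range x)) M 0 ∧ EF (Ideal.span (Set.range x)) M 1)
      ?_ ?_ ?_ ?_ k M ⟨hk, htor, h0, h1⟩ hkk
    · rintro M _ _ ⟨hk, htor, h0, h1⟩
      exact hkerall M hk htor h0 h1
    · rintro M _ _ ⟨hk, htor, h0, h1⟩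
      refine ⟨fun i hi m => Subtype.ext (hk i hi m), ?_,
        EF.sub _ _ (rangeMul (x j) M).injective_subtype h0, hr1 M hk htor h0 h1⟩
      intro m i
      obtain ⟨k, hk⟩ := htor m i
      exact ⟨k, Subtype.ext (by simpa using hk)⟩
    · rintro M _ _ ⟨hk, htor, h0, h1⟩ h
      have hQ0 : EF (Ideal.span (Set.range x)) (M ⧸ rangeMul (x j) M) 0 :=
        EF.right _ _ _ (rangeMul (x j) M).injective_subtype (rangeMul (x j) M).mkQ_surjective
          (range_exact _ M) 0 h0 (hr1 M hk htor h0 h1)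
      have hQk : ∀ i ∉ insert j T, ∀ m : M ⧸ rangeMul (x j) M, x i • m = 0 := by
        intro i hi m
        obtain ⟨m, rfl⟩ := Submodule.mkQ_surjective _ m
        rw [← map_smul, hk i hi, map_zero]
      refine art_main x (insert j T) _ hQk ?_ hQ0
      refine SArt.of_kilX x (insert j T) _ ?_ hQk ?_
      · intro m i
        obtain ⟨m, rfl⟩ := Submodule.mkQ_surjective _ m
        obtain ⟨k, hk⟩ := htor m i
        exact ⟨k, by rw [← map_smul, hk, map_zero]⟩
      · have := (EF_zero_iff x _).1 hQ0
        refine sart_bot_finite _ hdim _ inferInstance ?_ ?_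
        · intro r hr w
          exact Subtype.ext ((mem_kilX' x _ w.1).1 w.2 r hr)
        · rintro ⟨w, hw⟩
          obtain ⟨m, rfl⟩ := Submodule.mkQ_surjective _ w
          obtain ⟨s, hs, m', hm⟩ := h m
          refine ⟨s, hs, Subtype.ext ?_⟩
          show s • (rangeMul (x j) M).mkQ m = 0
          rw [← map_smul, hm, Submodule.mkQ_apply, Submodule.Quotient.mk_eq_zero]
          exact ⟨m', rfl⟩
    · rintro M _ _ ⟨hk, htor, h0, h1⟩
      exact h0


section bridgeExt

lemma extMk_eq_zero_iff₀ {X Y : ModuleCat.{0} A} (P : ProjectiveResolution X)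
    (f : P.complex.X 0 ⟶ Y) (hf : P.complex.d 1 0 ≫ f = 0) :
    P.extMk f 1 rfl hf = 0 ↔ f = 0 := by
  constructor
  · intro h
    simp only [← P.extEquivCohomologyClass.apply_eq_iff_eq,
      ProjectiveResolution.extEquivCohomologyClass_extMk,
      ProjectiveResolution.extEquivCohomologyClass_zero,
      CochainComplex.HomComplex.CohomologyClass.mk_eq_zero_iff] at h
    rw [CochainComplex.HomComplex.Cocycle.toSingleMk_mem_coboundaries_iff _ _ _ _ _ 1
      (by simp)] at h
    obtain ⟨g, hg⟩ := h
    have hz : IsZero (P.cochainComplex.X 1) :=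
      CochainComplex.isZero_of_isStrictlyLE P.cochainComplex 0 1
    rw [hz.eq_of_src g 0, comp_zero] at hg
    rw [← cancel_epi (P.cochainComplexXIso (-(0 : ℕ)) 0 rfl).hom, ← hg, comp_zero]
  · rintro rfl
    simp

variable {X Y : ModuleCat.{0} A} (P : ProjectiveResolution X)

lemma smul_extMk {n : ℕ} (f : P.complex.X n ⟶ Y) (hf : P.complex.d (n + 1) n ≫ f = 0) (r : A) :
    P.extMk (r • f) (n + 1) rfl (by rw [Linear.comp_smul, hf, smul_zero]) =
      r • P.extMk f (n + 1) rfl hf := by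
  rw [CategoryTheory.Abelian.Ext.smul_eq_comp_mk₀, P.extMk_comp_mk₀]
  simp

/-- classes of cocycles -/
def cocycleClass (n : ℕ) : LinearMap.ker ((P.complex.linearYonedaObj A Y).d n (n + 1)).hom →ₗ[A]
    CategoryTheory.Abelian.Ext X Y n where
  toFun f := P.extMk (show P.complex.X n ⟶ Y from f.1) (n + 1) rfl f.2
  map_add' f g := (P.add_extMk (show P.complex.X n ⟶ Y from f.1)
    (show P.complex.X n ⟶ Y from g.1) (n + 1) rfl f.2 g.2).symm
  map_smul' r f := by
    exact smul_extMk P (show P.complex.X n ⟶ Y from f.1) f.2 r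

lemma cocycleClass_surj (n : ℕ) : Function.Surjective (cocycleClass (Y := Y) P n) := by
  intro α
  obtain ⟨f, hf, rfl⟩ := P.extMk_surjective α (n + 1) rfl
  exact ⟨⟨f, hf⟩, rfl⟩

lemma cocycleClass_ker (n i : ℕ) (hi : (ComplexShape.up ℕ).prev n = i) :
    LinearMap.ker (cocycleClass (Y := Y) P n) =
    LinearMap.range ((P.complex.linearYonedaObj A Y).sc' i n (n + 1)).moduleCatToCycles := by
  ext f
  obtain ⟨f, hf⟩ := f
  cases n with
  | zero =>
    have : i = 0 := by rw [← hi]; simp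
    subst this
    have h0 : P.complex.d 0 0 = 0 := P.complex.shape 0 0 (by simp)
    rw [LinearMap.mem_ker]
    refine (extMk_eq_zero_iff₀ P f hf).trans ⟨fun h => ⟨0, Subtype.ext ?_⟩, fun ⟨g, hg⟩ => ?_⟩
    · rw [map_zero]
      exact h.symm
    · have h2 : P.complex.d 0 0 ≫ (show P.complex.X 0 ⟶ Y from g) = f := congrArg Subtype.val hg
      rw [h0, zero_comp] at h2
      exact h2.symm
  | succ n =>
    have : i = n := by rw [← hi]; simp
    subst this
    rw [LinearMap.mem_ker]
    refine (P.extMk_eq_zero_iff f (i + 1 + 1) rfl hf i rfl).trans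
      ⟨fun ⟨g, hg⟩ => ⟨g, Subtype.ext hg⟩, fun ⟨g, hg⟩ => ⟨g, congrArg Subtype.val hg⟩⟩

/-- auxiliary quotient equivalence -/
def quotEquivGen {M N : Type*} [AddCommGroup M] [Module A M] [AddCommGroup N] [Module A N]
    (B : Submodule A M) (ψ : M →ₗ[A] N) (h : LinearMap.ker ψ = B) (hs : Function.Surjective ψ) :
    (M ⧸ B) ≃ₗ[A] N :=
  (Submodule.quotEquivOfEq _ _ h.symm).trans (LinearMap.quotKerEquivOfSurjective _ hs)

/-- auxiliary quotient equivalence -/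
def extCompareAux (n : ℕ) : ↥(((P.complex.linearYonedaObj A Y).sc' ((ComplexShape.up ℕ).prev n)
      n (n + 1)).moduleCatLeftHomologyData.H) ≃ₗ[A] CategoryTheory.Abelian.Ext X Y n :=
  quotEquivGen (M := LinearMap.ker ((P.complex.linearYonedaObj A Y).sc' ((ComplexShape.up ℕ).prev n)
      n (n + 1)).g.hom) (LinearMap.range ((P.complex.linearYonedaObj A Y).sc'
        ((ComplexShape.up ℕ).prev n) n (n + 1)).moduleCatToCycles) (cocycleClass P n)
      (cocycleClass_ker P n _ rfl) (cocycleClass_surj (Y := Y) P n)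

/-- comparison of the two Ext modules -/
def extCompare (n : ℕ) : ↥(((_root_.Ext A (ModuleCat A) n).obj (Opposite.op X)).obj Y) ≃ₗ[A]
    CategoryTheory.Abelian.Ext X Y n :=
  ((P.isoExt n Y).toLinearEquiv.trans
    (((P.complex.linearYonedaObj A Y).homologyIsoSc' _ n (n + 1) rfl (by simp)).toLinearEquiv.trans
      (ShortComplex.moduleCatHomologyIso _).toLinearEquiv)).trans
    (extCompareAux P n)

end bridgeExt

lemma extQuot_finite_iff [IsNoetherianRing A] (𝔞 : Ideal A) (M : Type) [AddCommGroup M]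
    [Module A M] (i : ℕ) : Module.Finite A (extQuot 𝔞 M i) ↔ EF 𝔞 M i := by
  have e := extCompare (A := A) (X := ModuleCat.of A (A ⧸ 𝔞)) (Y := ModuleCat.of A M)
    (ProjectiveResolution.of _) i
  constructor
  · intro h
    have : IsNoetherian A (extQuot 𝔞 M i) := isNoetherian_of_isNoetherianRing_of_finite A _
    exact isNoetherian_of_linearEquiv e
  · intro h
    unfold EF at h
    exact Module.Finite.equiv e.symm

lemma torsion_of_supp [IsNoetherianRing A] {t : ℕ} (x : Fin t → A) (M : Type) [AddCommGroup M]
    [Module A M] (hsupp : Module.support A M ⊆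
      PrimeSpectrum.zeroLocus (Ideal.span (Set.range x) : Set A)) (m : M) (i : Fin t) :
    ∃ k : ℕ, x i ^ k • m = 0 := by
  have h : x i ∈ (Submodule.annihilator (Submodule.span A {m})).radical := by
    rw [Ideal.radical_eq_sInf, Submodule.mem_sInf]
    rintro p ⟨hp, hpp⟩
    have hm : (⟨p, hpp⟩ : PrimeSpectrum A) ∈ Module.support A M := by
      rw [Module.mem_support_iff_exists_annihilator]
      exact ⟨m, hp⟩
    exact hsupp hm (Ideal.subset_span ⟨i, rfl⟩)
  obtain ⟨k, hk⟩ := h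
  refine ⟨k, ?_⟩
  exact (Submodule.mem_annihilator_span_singleton m _).1 hk


section bridgeKoszul

variable {t : ℕ} (x : Fin t → A) (M : Type) [AddCommGroup M] [Module A M]

/-- extension of a cochain by zero -/
def extF {i : ℕ} (f : KoszulCochain x M i) (s : Finset (Fin t)) : M :=
  if h : s.card = i then f ⟨s, h⟩ else 0

lemma extF_eq {i : ℕ} (f : KoszulCochain x M i) (s : Finset (Fin t)) (h : s.card = i) :
    extF x M f s = f ⟨s, h⟩ := dif_pos h

lemma koszulD_apply {i : ℕ} (f : KoszulCochain x M i) (s : {s : Finset (Fin t) // s.card = i + 1}) :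
    koszulD x M i f s = ∑ j ∈ s.1,
      (((-1 : A) ^ ((s.1.filter (fun k => k < j)).card)) * x j) • extF x M f (s.1.erase j) := by
  rw [← Finset.sum_attach s.1]
  simp only [koszulD, LinearMap.pi_apply, LinearMap.sum_apply, LinearMap.smul_apply,
    LinearMap.proj_apply]
  refine Finset.sum_congr rfl fun j _ => ?_
  rw [extF_eq]

lemma koszulD_zero (f : KoszulCochain x M 0) (i : Fin t) :
    koszulD x M 0 f ⟨{i}, Finset.card_singleton i⟩ = x i • f ⟨∅, rfl⟩ := by
  rw [koszulD_apply]
  simp only [Finset.sum_singleton, Finset.erase_singleton]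
  rw [extF_eq x M f ∅ rfl, Finset.filter_singleton]
  simp

lemma koszulD_one (f : KoszulCochain x M 1) (a b : Fin t) (hab : a < b) :
    koszulD x M 1 f ⟨{a, b}, Finset.card_pair hab.ne⟩ =
      x a • f ⟨{b}, Finset.card_singleton b⟩ - x b • f ⟨{a}, Finset.card_singleton a⟩ := by
  rw [koszulD_apply]
  simp only
  rw [Finset.sum_pair hab.ne]
  have h1 : ({a, b} : Finset (Fin t)).erase a = {b} := by
    ext c; simp only [Finset.mem_erase, Finset.mem_insert, Finset.mem_singleton]
    constructor
    · rintro ⟨h, h' | h'⟩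
      · exact absurd h' h
      · exact h'
    · rintro rfl
      exact ⟨hab.ne', Or.inr rfl⟩
  have h2 : ({a, b} : Finset (Fin t)).erase b = {a} := by
    ext c; simp only [Finset.mem_erase, Finset.mem_insert, Finset.mem_singleton]
    constructor
    · rintro ⟨h, h' | h'⟩
      · exact h'
      · exact absurd h' h
    · rintro rfl
      exact ⟨hab.ne, Or.inl rfl⟩
  have h3 : ({a, b} : Finset (Fin t)).filter (fun k => k < a) = ∅ := by
    ext c; simp only [Finset.mem_filter, Finset.mem_insert, Finset.mem_singleton,
      Finset.notMem_empty, iff_false]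
    rintro ⟨rfl | rfl, h⟩
    · exact lt_irrefl _ h
    · exact lt_asymm hab h
  have h4 : ({a, b} : Finset (Fin t)).filter (fun k => k < b) = {a} := by
    ext c; simp only [Finset.mem_filter, Finset.mem_insert, Finset.mem_singleton]
    constructor
    · rintro ⟨rfl | rfl, h⟩
      · rfl
      · exact absurd h (lt_irrefl _)
    · rintro rfl
      exact ⟨Or.inl rfl, hab⟩
  rw [h1, h2, h3, h4, extF_eq x M f {b} (Finset.card_singleton b),
    extF_eq x M f {a} (Finset.card_singleton a)]
  simp [sub_eq_add_neg]

/-- value of a one-cochain -/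
abbrev val1 (f : KoszulCochain x M 1) (i : Fin t) : M := f ⟨{i}, Finset.card_singleton i⟩

lemma ext1 {f g : KoszulCochain x M 1} (h : ∀ i, val1 x M f i = val1 x M g i) : f = g := by
  funext s
  obtain ⟨s, hs⟩ := s
  obtain ⟨i, rfl⟩ := Finset.card_eq_one.1 hs
  exact h i

lemma mem_ker_D0 (f : KoszulCochain x M 0) :
    f ∈ LinearMap.ker (koszulD x M 0) ↔ ∀ i, x i • f ⟨∅, rfl⟩ = 0 := by
  rw [LinearMap.mem_ker]
  constructor
  · intro h i
    rw [← koszulD_zero, h]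
    rfl
  · intro h
    apply ext1 x M
    intro i
    exact (koszulD_zero x M f i).trans (h i)

lemma mem_ker_D1 (f : KoszulCochain x M 1) :
    f ∈ LinearMap.ker (koszulD x M 1) ↔ ∀ a b, x a • val1 x M f b = x b • val1 x M f a := by
  rw [LinearMap.mem_ker]
  constructor
  · intro h
    have key : ∀ a b, a < b → x a • val1 x M f b = x b • val1 x M f a := by
      intro a b hab
      rw [← sub_eq_zero, ← koszulD_one x M f a b hab, h]
      rfl
    intro a b
    rcases lt_trichotomy a b with hab | rfl | hab
    · exact key a b hab
    · rfl
    · exact (key b a hab).symm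
  · intro h
    funext s
    obtain ⟨s, hs⟩ := s
    obtain ⟨a, b, hab, rfl⟩ := Finset.card_eq_two.1 hs
    rcases lt_or_gt_of_ne hab with hab | hab
    · rw [koszulD_one x M f a b hab]
      exact sub_eq_zero.2 (h a b)
    · have : (⟨{a, b}, hs⟩ : {s : Finset (Fin t) // s.card = 1 + 1}) =
          ⟨{b, a}, Finset.card_pair hab.ne⟩ := Subtype.ext (Finset.pair_comm a b)
      rw [this, koszulD_one x M f b a hab]
      exact sub_eq_zero.2 (h b a)

lemma mem_boundary_one (f : KoszulCochain x M 1) :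
    f ∈ koszulBoundary x M 1 ↔ ∃ m : M, ∀ i, val1 x M f i = x i • m := by
  constructor
  · rintro ⟨g, rfl⟩
    exact ⟨g ⟨∅, rfl⟩, fun i => koszulD_zero x M g i⟩
  · rintro ⟨m, hm⟩
    refine ⟨fun _ => m, ext1 x M fun i => ?_⟩
    rw [hm]
    exact koszulD_zero x M _ i

lemma H0_iff [IsNoetherianRing A] :
    Module.Finite A (KoszulCohomology x M 0) ↔ IsNoetherian A (kilX x M) := by
  constructor
  · intro h
    have : IsNoetherian A (KoszulCohomology x M 0) :=
      isNoetherian_of_isNoetherianRing_of_finite A _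
    let g : kilX x M →ₗ[A] LinearMap.ker (koszulD x M 0) :=
      LinearMap.codRestrict _ (LinearMap.pi fun _ => (kilX x M).subtype)
        (fun m => (mem_ker_D0 x M _).2 fun i => m.2 i)
    refine isNoetherian_of_injective ((Submodule.mkQ _ : _ →ₗ[A] KoszulCohomology x M 0) ∘ₗ g) ?_
    rw [injective_iff_map_eq_zero]
    intro m hm
    have h2 : g m ∈ (koszulBoundary x M 0).comap (LinearMap.ker (koszulD x M 0)).subtype :=
      (Submodule.Quotient.mk_eq_zero _).1 hm
    have h3 : (g m).1 = 0 := h2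
    exact Subtype.ext (congrFun h3 ⟨∅, rfl⟩)
  · intro h
    let g : LinearMap.ker (koszulD x M 0) →ₗ[A] kilX x M :=
      LinearMap.codRestrict _ ((LinearMap.proj (⟨∅, rfl⟩ : {s : Finset (Fin t) // s.card = 0}) :
        KoszulCochain x M 0 →ₗ[A] M) ∘ₗ (LinearMap.ker (koszulD x M 0)).subtype) (fun f => (mem_ker_D0 x M f.1).1 f.2)
    have : IsNoetherian A (LinearMap.ker (koszulD x M 0)) := by
      refine isNoetherian_of_injective g ?_
      intro f f' hff
      apply Subtype.ext
      funext s
      obtain ⟨s, hs⟩ := s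
      obtain rfl := Finset.card_eq_zero.1 hs
      exact congrArg Subtype.val hff
    infer_instance

/-- connecting map -/
def delta1 (𝔞 : Ideal A) : (𝔞 →ₗ[A] M) →ₗ[A]
    CategoryTheory.Abelian.Ext (ModuleCat.of A (A ⧸ 𝔞)) (ModuleCat.of A M) 1 :=
  ((scOf_shortExact 𝔞.subtype 𝔞.mkQ 𝔞.injective_subtype 𝔞.mkQ_surjective
    (LinearMap.exact_subtype_mkQ 𝔞)).extClass.precompOfLinear A (ModuleCat.of A M) (add_zero 1)) ∘ₗ
    (CategoryTheory.Abelian.Ext.linearEquiv₀.trans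
      (ModuleCat.homLinearEquiv (M := ModuleCat.of A 𝔞) (N := ModuleCat.of A M) (S := A))).symm.toLinearMap

lemma delta1_surj (𝔞 : Ideal A) : Function.Surjective (delta1 M 𝔞) := by
  intro z
  have : Projective (ModuleCat.of A A) := ModuleCat.projective_of_free (Module.Basis.singleton Unit A)
  obtain ⟨w, hw⟩ := CategoryTheory.Abelian.Ext.contravariant_sequence_exact₃
    (scOf_shortExact 𝔞.subtype 𝔞.mkQ 𝔞.injective_subtype 𝔞.mkQ_surjective
    (LinearMap.exact_subtype_mkQ 𝔞)) (ModuleCat.of A M) z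
    (CategoryTheory.Abelian.Ext.eq_zero_of_projective (P := ModuleCat.of A A) _) (add_zero 1)
  refine ⟨(CategoryTheory.Abelian.Ext.linearEquiv₀.trans
      (ModuleCat.homLinearEquiv (M := ModuleCat.of A 𝔞) (N := ModuleCat.of A M) (S := A))) w, ?_⟩
  rw [delta1, LinearMap.comp_apply, LinearEquiv.coe_coe, LinearEquiv.symm_apply_apply]
  exact hw

lemma delta1_apply (𝔞 : Ideal A) (φ : 𝔞 →ₗ[A] M) : delta1 M 𝔞 φ =
    (scOf_shortExact 𝔞.subtype 𝔞.mkQ 𝔞.injective_subtype 𝔞.mkQ_surjective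
    (LinearMap.exact_subtype_mkQ 𝔞)).extClass.comp
      (CategoryTheory.Abelian.Ext.mk₀ (ModuleCat.ofHom φ)) (add_zero 1) := rfl

lemma delta1_eq_zero (𝔞 : Ideal A) (φ : 𝔞 →ₗ[A] M) :
    delta1 M 𝔞 φ = 0 ↔ ∃ m : M, ∀ a : 𝔞, φ a = a.1 • m := by
  rw [delta1_apply]
  constructor
  · intro h
    obtain ⟨v, hv⟩ := CategoryTheory.Abelian.Ext.contravariant_sequence_exact₁ _ _ _ _ h
    obtain ⟨ψ, rfl⟩ := (CategoryTheory.Abelian.Ext.mk₀_bijective _ _).2 v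
    rw [CategoryTheory.Abelian.Ext.mk₀_comp_mk₀] at hv
    have h2 := (CategoryTheory.Abelian.Ext.mk₀_bijective _ _).1 hv
    have h3 : ψ.hom ∘ₗ 𝔞.subtype = φ := congrArg ModuleCat.Hom.hom h2
    refine ⟨ψ.hom (1 : A), fun a => ?_⟩
    rw [← h3]
    have := (map_smul ψ.hom a.1 (1 : A)).symm
    refine Eq.trans ?_ this.symm
    show ψ.hom a.1 = ψ.hom (a.1 • (1 : A))
    rw [smul_eq_mul, mul_one]
  · rintro ⟨m, hm⟩
    have h : φ = LinearMap.toSpanSingleton A M m ∘ₗ 𝔞.subtype := LinearMap.ext hm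
    have h2 : ModuleCat.ofHom φ =
        ModuleCat.ofHom 𝔞.subtype ≫ ModuleCat.ofHom (LinearMap.toSpanSingleton A M m) := by
      rw [h]; rfl
    rw [h2, ← CategoryTheory.Abelian.Ext.mk₀_comp_mk₀]
    exact ShortComplex.ShortExact.extClass_comp_assoc _ _

/-- from homomorphisms to Koszul cohomology -/
def thetaZ : (Ideal.span (Set.range x) →ₗ[A] M) →ₗ[A] LinearMap.ker (koszulD x M 1) :=
  LinearMap.codRestrict _ (LinearMap.pi fun s => ∑ i ∈ s.1,
    LinearMap.applyₗ (⟨x i, Ideal.subset_span ⟨i, rfl⟩⟩ : Ideal.span (Set.range x))) (by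
    intro φ
    rw [mem_ker_D1]
    intro a b
    simp only [val1, LinearMap.pi_apply, Finset.sum_singleton, LinearMap.applyₗ_apply_apply]
    rw [← map_smul, ← map_smul]
    congr 1
    exact Subtype.ext (mul_comm _ _))

lemma thetaZ_val (φ : Ideal.span (Set.range x) →ₗ[A] M) (i : Fin t) :
    val1 x M (thetaZ x M φ).1 i = φ ⟨x i, Ideal.subset_span ⟨i, rfl⟩⟩ := by
  simp [thetaZ, val1]

/-- from homomorphisms to Koszul cohomology -/
def theta : (Ideal.span (Set.range x) →ₗ[A] M) →ₗ[A] KoszulCohomology x M 1 :=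
  Submodule.mkQ _ ∘ₗ thetaZ x M

/-- surjection from the free module to the ideal -/
def Lmap : (Fin t → A) →ₗ[A] Ideal.span (Set.range x) :=
  LinearMap.codRestrict _ (Fintype.linearCombination A x) (fun c => by
    have : Fintype.linearCombination A x c ∈ LinearMap.range (Fintype.linearCombination A x) :=
      ⟨c, rfl⟩
    rw [Fintype.range_linearCombination] at this
    exact this)

lemma Lmap_val (c : Fin t → A) : (Lmap x c).1 = ∑ i, c i * x i := by
  simp [Lmap, Fintype.linearCombination_apply]

lemma Lmap_surj : Function.Surjective (Lmap x) := by
  rintro ⟨a, ha⟩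
  have : a ∈ LinearMap.range (Fintype.linearCombination A x) := by
    rw [Fintype.range_linearCombination]
    exact ha
  obtain ⟨c, hc⟩ := this
  exact ⟨c, Subtype.ext hc⟩

lemma Lmap_single (i : Fin t) :
    Lmap x (Pi.single i 1) = ⟨x i, Ideal.subset_span ⟨i, rfl⟩⟩ := by
  apply Subtype.ext
  rw [Lmap_val]
  simp [Pi.single_apply]

lemma hom_apply_Lmap (φ : Ideal.span (Set.range x) →ₗ[A] M) (c : Fin t → A) :
    φ (Lmap x c) = ∑ i, c i • φ ⟨x i, Ideal.subset_span ⟨i, rfl⟩⟩ := by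
  have : Lmap x c = ∑ i, c i • (⟨x i, Ideal.subset_span ⟨i, rfl⟩⟩ : Ideal.span (Set.range x)) := by
    apply Subtype.ext
    rw [Lmap_val]
    simp
  rw [this, map_sum]
  exact Finset.sum_congr rfl fun i _ => map_smul φ _ _

lemma theta_eq_zero (φ : Ideal.span (Set.range x) →ₗ[A] M) :
    theta x M φ = 0 ↔ ∃ m : M, ∀ a : Ideal.span (Set.range x), φ a = a.1 • m := by
  have h : theta x M φ = 0 ↔ (thetaZ x M φ).1 ∈ koszulBoundary x M 1 :=
    Submodule.Quotient.mk_eq_zero _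
  rw [h, mem_boundary_one]
  refine exists_congr fun m => ?_
  constructor
  · intro h a
    obtain ⟨c, rfl⟩ := Lmap_surj x a
    rw [hom_apply_Lmap, Lmap_val, Finset.sum_smul]
    refine Finset.sum_congr rfl fun i _ => ?_
    rw [← thetaZ_val, h, smul_smul]
  · intro h i
    rw [thetaZ_val, h]

lemma ker_theta : LinearMap.ker (delta1 M (Ideal.span (Set.range x))) =
    LinearMap.ker (theta x M) := by
  ext φ
  rw [LinearMap.mem_ker, LinearMap.mem_ker, delta1_eq_zero, theta_eq_zero]

/-- syzygy map -/
def syzZ (c : LinearMap.ker (Lmap x)) : LinearMap.ker (koszulD x M 1) →ₗ[A] kilX x M :=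
  LinearMap.codRestrict _ (∑ i, c.1 i • (LinearMap.proj
    (⟨{i}, Finset.card_singleton i⟩ : {s : Finset (Fin t) // s.card = 1})) ∘ₗ
        (LinearMap.ker (koszulD x M 1)).subtype) (by
    intro f j
    have hf := (mem_ker_D1 x M f.1).1 f.2
    have hc : ∑ i, c.1 i * x i = 0 := by
      rw [← Lmap_val, c.2]
      rfl
    simp only [LinearMap.sum_apply, LinearMap.smul_apply, LinearMap.comp_apply,
      LinearMap.proj_apply, Submodule.subtype_apply]
    rw [Finset.smul_sum]
    calc ∑ i, x j • c.1 i • val1 x M f.1 i = ∑ i, (c.1 i * x i) • val1 x M f.1 j := by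
          refine Finset.sum_congr rfl fun i _ => ?_
          rw [smul_comm, hf j i, smul_smul]
      _ = 0 := by rw [← Finset.sum_smul, hc, zero_smul])

lemma syzZ_val (c : LinearMap.ker (Lmap x)) (f : LinearMap.ker (koszulD x M 1)) :
    (syzZ x M c f).1 = ∑ i, c.1 i • val1 x M f.1 i := by
  simp [syzZ]

/-- syzygy map on cohomology -/
def syzH (c : LinearMap.ker (Lmap x)) : KoszulCohomology x M 1 →ₗ[A] kilX x M :=
  Submodule.liftQ _ (syzZ x M c) (by
    intro f hf
    obtain ⟨m, hm⟩ := (mem_boundary_one x M f.1).1 hf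
    rw [LinearMap.mem_ker]
    apply Subtype.ext
    rw [syzZ_val]
    have hc : ∑ i, c.1 i * x i = 0 := by
      rw [← Lmap_val, c.2]
      rfl
    calc ∑ i, c.1 i • val1 x M f.1 i = ∑ i, (c.1 i * x i) • m := by
          refine Finset.sum_congr rfl fun i _ => ?_
          rw [hm, smul_smul]
      _ = 0 := by rw [← Finset.sum_smul, hc, zero_smul])

lemma mem_range_theta (f : LinearMap.ker (koszulD x M 1))
    (hf : ∀ c : LinearMap.ker (Lmap x), syzZ x M c f = 0) : ∃ φ, thetaZ x M φ = f := by
  have hle : LinearMap.ker (Lmap x) ≤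
      LinearMap.ker (Fintype.linearCombination A (fun i => val1 x M f.1 i)) := by
    intro c hc
    rw [LinearMap.mem_ker, Fintype.linearCombination_apply, ← syzZ_val x M ⟨c, hc⟩, hf]
    rfl
  let φ : Ideal.span (Set.range x) →ₗ[A] M := (Submodule.liftQ _ _ hle) ∘ₗ
    ((Lmap x).quotKerEquivOfSurjective (Lmap_surj x)).symm.toLinearMap
  have hφ : ∀ c, φ (Lmap x c) = ∑ i, c i • val1 x M f.1 i := by
    intro c
    have : ((Lmap x).quotKerEquivOfSurjective (Lmap_surj x)).symm (Lmap x c) =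
        Submodule.Quotient.mk c := by
      rw [LinearEquiv.symm_apply_eq]
      rfl
    simp only [φ, LinearMap.comp_apply, LinearEquiv.coe_coe]
    rw [this, Submodule.liftQ_apply, Fintype.linearCombination_apply]
  refine ⟨φ, Subtype.ext (ext1 x M fun i => ?_)⟩
  rw [thetaZ_val, ← Lmap_single, hφ]
  simp [Pi.single_apply]

lemma H1_iff [IsNoetherianRing A] (h0 : IsNoetherian A (kilX x M)) :
    Module.Finite A (KoszulCohomology x M 1) ↔ EF (Ideal.span (Set.range x)) M 1 := by
  constructor
  · intro h
    have : IsNoetherian A (KoszulCohomology x M 1) :=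
      isNoetherian_of_isNoetherianRing_of_finite A _
    have h2 : IsNoetherian A (LinearMap.range (theta x M)) := inferInstance
    exact isNoetherian_of_linearEquiv ((LinearMap.quotKerEquivRange (theta x M)).symm.trans
      (quotEquivGen _ (delta1 M (Ideal.span (Set.range x))) (ker_theta x M) (delta1_surj M _)))
  · intro h1
    unfold EF at h1
    obtain ⟨S, hS⟩ := (IsNoetherian.noetherian (⊤ : Submodule A (LinearMap.ker (Lmap x))))
    have h3 : IsNoetherian A ((Ideal.span (Set.range x) →ₗ[A] M) ⧸ LinearMap.ker (theta x M)) :=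
      isNoetherian_of_linearEquiv (quotEquivGen _ (delta1 M (Ideal.span (Set.range x)))
        (ker_theta x M) (delta1_surj M _)).symm
    have h4 : IsNoetherian A (KoszulCohomology x M 1) := by
      refine noeth_mid (Submodule.liftQ _ (theta x M) le_rfl)
        (LinearMap.pi fun c : S => syzH x M c.1) ?_ h3 inferInstance
      intro y hy
      obtain ⟨f, rfl⟩ := Submodule.mkQ_surjective _ y
      have hfS : ∀ c ∈ S, syzZ x M c f = 0 := fun c hc => congrFun hy ⟨c, hc⟩
      have hf : ∀ c : LinearMap.ker (Lmap x), syzZ x M c f = 0 := by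
        intro c
        have hc : c ∈ Submodule.span A (S : Set (LinearMap.ker (Lmap x))) := by
          rw [hS]; trivial
        apply Subtype.ext
        rw [syzZ_val]
        show _ = (0 : M)
        induction hc using Submodule.span_induction with
        | mem c hc => rw [← syzZ_val, hfS c hc]; rfl
        | zero => simp
        | add c d _ _ hc hd =>
          simp only [Submodule.coe_add, Pi.add_apply, add_smul, Finset.sum_add_distrib, hc, hd,
            add_zero]
        | smul r c _ hc =>
          simp only [Submodule.coe_smul, Pi.smul_apply, smul_assoc, ← Finset.smul_sum, hc,
            smul_zero]
      obtain ⟨φ, hφ⟩ := mem_range_theta x M f hf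
      refine ⟨Submodule.Quotient.mk φ, ?_⟩
      rw [Submodule.liftQ_apply, ← hφ]
      rfl
    infer_instance

end bridgeKoszul


/-- If `𝔞 = (x₁, …, x_t)`, `dim A/𝔞 = 1`, and `Supp M ⊆ V(𝔞)`, then `M` is `𝔞`-cofinite
iff `H^0(x,M)` and `H^1(x,M)` are finitely generated. -/
theorem stmt10 [IsNoetherianRing A] (𝔞 : Ideal A) {t : ℕ} (x : Fin t → A)
    (hgen : 𝔞 = Ideal.span (Set.range x))
    (hdim : ringKrullDim (A ⧸ 𝔞) = 1)
    (M : Type) [AddCommGroup M] [Module A M]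
    (hsupp : Module.support A M ⊆ PrimeSpectrum.zeroLocus (𝔞 : Set A)) :
    IsCofinite 𝔞 M ↔
      (Module.Finite A (KoszulCohomology x M 0) ∧
        Module.Finite A (KoszulCohomology x M 1)) := by
  subst hgen
  have htor := torsion_of_supp x M hsupp
  constructor
  · rintro ⟨-, h⟩
    have h0 := (EF_zero_iff x M).1 ((extQuot_finite_iff _ M 0).1 (h 0))
    exact ⟨(H0_iff x M).2 h0, (H1_iff x M h0).2 ((extQuot_finite_iff _ M 1).1 (h 1))⟩
  · rintro ⟨h0, h1⟩
    have h0' := (H0_iff x M).1 h0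
    refine ⟨hsupp, fun i => (extQuot_finite_iff _ M i).2 ?_⟩
    exact cof_main x hdim Finset.univ M (fun i hi => absurd (Finset.mem_univ i) hi) htor
      ((EF_zero_iff x M).2 h0') ((H1_iff x M h0').1 h1) i

end
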